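/- Let p and p' be real numbers with 1 < p < ∞ and 1/p + 1/p' = 1. Let W = [−1,1] × [0,1] ⊂ ℝ², S = [−1,0] × [0,1], and K = (0,1] × [0,1]. Let ε > 0 and let φ : ℝ² → ℝ be C¹ on a neighborhood of W such that ∫_S |φ| dx¹ dx² < ε, ∫_K |1 − φ| dx¹ dx² < ε, and (∫_W |∂φ/∂x¹|^p dx¹ dx²)^{1/p} < ε. Then 1 < (2 + 2^{1/p'}) ε. In particular, if ε ≤ 1/(2 + 2^{1/p'}), then no function that is C¹ on a neighborhood of W satisfies all three inequalities; hence the step function u(x¹,x²) = 1 for x¹ > 0 and u(x¹,x²) = 0 for x¹ ≤ 0 cannot be approximated in the first-order Sobolev norm ‖v‖_p + ‖∇v‖_p on W by C¹ functions. -/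

import Mathlib

open MeasureTheory

lemma aux_fubini (a b : ℝ) (hab : a ≤ b) (f : ℝ × ℝ → ℝ)
    (hf : ContinuousOn f (Set.Icc a b ×ˢ Set.Icc (0 : ℝ) 1)) :
    IntegrableOn (fun t => ∫ x in a..b, f (x, t)) (Set.Icc (0 : ℝ) 1) ∧
    (∫ x in Set.Icc a b ×ˢ Set.Icc (0 : ℝ) 1, f x)
      = ∫ t in Set.Icc (0 : ℝ) 1, ∫ x in a..b, f (x, t) := by
  have hi : IntegrableOn f (Set.Icc a b ×ˢ Set.Icc (0 : ℝ) 1) :=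
    hf.integrableOn_compact (isCompact_Icc.prod isCompact_Icc)
  have hr : (volume : Measure (ℝ × ℝ)).restrict (Set.Icc a b ×ˢ Set.Icc (0 : ℝ) 1)
      = ((volume : Measure ℝ).restrict (Set.Icc a b)).prod
        ((volume : Measure ℝ).restrict (Set.Icc (0 : ℝ) 1)) := by
    rw [Measure.prod_restrict]; rfl
  have hi' := hi
  unfold IntegrableOn at hi'
  rw [hr] at hi'
  have he : (fun t => ∫ x in a..b, f (x, t)) = fun t => ∫ x in Set.Icc a b, f (x, t) := by
    funext t
    rw [intervalIntegral.integral_of_le hab, integral_Icc_eq_integral_Ioc]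
  rw [he]
  refine ⟨hi'.integral_prod_right, ?_⟩
  rw [hr, integral_prod_symm _ hi']

lemma aux_holder (p p' : ℝ) (hp : 1 < p) (hpp' : 1 / p + 1 / p' = 1) (f : ℝ × ℝ → ℝ)
    (hf : ContinuousOn f (Set.Icc (-1 : ℝ) 1 ×ˢ Set.Icc (0 : ℝ) 1)) :
    (∫ x in Set.Icc (-1 : ℝ) 1 ×ˢ Set.Icc (0 : ℝ) 1, |f x|)
      ≤ (2 : ℝ) ^ (1 / p') *
        (∫ x in Set.Icc (-1 : ℝ) 1 ×ˢ Set.Icc (0 : ℝ) 1, |f x| ^ p) ^ (1 / p) := by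
  have hc : p.HolderConjugate p' := by
    rw [Real.holderConjugate_iff]
    exact ⟨hp, by simpa using hpp'⟩
  have hms : MeasurableSet (Set.Icc (-1 : ℝ) 1 ×ˢ Set.Icc (0 : ℝ) 1) :=
    measurableSet_Icc.prod measurableSet_Icc
  have hcomp : IsCompact (Set.Icc (-1 : ℝ) 1 ×ˢ Set.Icc (0 : ℝ) 1) :=
    isCompact_Icc.prod isCompact_Icc
  have hvol : (volume : Measure (ℝ × ℝ)) (Set.Icc (-1 : ℝ) 1 ×ˢ Set.Icc (0 : ℝ) 1) = 2 := by
    rw [Measure.volume_eq_prod, Measure.prod_prod]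
    norm_num
  have : IsFiniteMeasure ((volume : Measure (ℝ × ℝ)).restrict
      (Set.Icc (-1 : ℝ) 1 ×ˢ Set.Icc (0 : ℝ) 1)) := ⟨by rw [Measure.restrict_apply_univ, hvol]; exact ENNReal.ofNat_lt_top⟩
  have h1 : MemLp f (ENNReal.ofReal p) ((volume : Measure (ℝ × ℝ)).restrict
      (Set.Icc (-1 : ℝ) 1 ×ˢ Set.Icc (0 : ℝ) 1)) := by
    obtain ⟨C, hC⟩ := hcomp.exists_bound_of_continuousOn hf
    refine MemLp.of_bound (hf.aestronglyMeasurable hms) C ?_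
    exact (ae_restrict_iff' hms).2 (Filter.Eventually.of_forall hC)
  have h2 : MemLp (fun _ : ℝ × ℝ => (1 : ℝ)) (ENNReal.ofReal p')
      ((volume : Measure (ℝ × ℝ)).restrict
      (Set.Icc (-1 : ℝ) 1 ×ˢ Set.Icc (0 : ℝ) 1)) := memLp_const 1
  have := integral_mul_norm_le_Lp_mul_Lq hc h1 h2
  have hreal : (volume : Measure (ℝ × ℝ)).real (Set.Icc (-1 : ℝ) 1 ×ˢ Set.Icc (0 : ℝ) 1) = 2 := by
    rw [Measure.real, hvol]; rfl
  simp only [Real.norm_eq_abs, abs_one, mul_one, Real.one_rpow, setIntegral_const, hreal,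
    smul_eq_mul] at this
  linarith


/-- Let `1 < p < ∞` with `1/p + 1/p' = 1`, let
`W = [−1,1] × [0,1]`, `S = [−1,0] × [0,1]`, `K = (0,1] × [0,1]`, let `ε > 0` and let
`φ : ℝ² → ℝ` be `C¹` on an (open) neighborhood of `W` with `∫_S |φ| < ε`,
`∫_K |1 − φ| < ε` and `(∫_W |∂φ/∂x¹|^p)^{1/p} < ε`. Then `1 < (2 + 2^{1/p'}) ε`.
In particular, for `ε ≤ 1/(2 + 2^{1/p'})` no `C¹` function satisfies all three
inequalities, so the step function `u = χ_{x¹>0}` cannot be approximated in the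
first-order Sobolev norm on `W` by `C¹` functions. -/
theorem step_function_not_approximable
    (p p' : ℝ) (hp : 1 < p) (hpp' : 1 / p + 1 / p' = 1)
    (ε : ℝ) (hε : 0 < ε)
    (φ : ℝ × ℝ → ℝ)
    (V : Set (ℝ × ℝ)) (hV : IsOpen V)
    (hWV : (Set.Icc (-1 : ℝ) 1) ×ˢ (Set.Icc (0 : ℝ) 1) ⊆ V)
    (hφ : ContDiffOn ℝ 1 φ V)
    (hS : (∫ x in (Set.Icc (-1 : ℝ) 0) ×ˢ (Set.Icc (0 : ℝ) 1), |φ x|) < ε)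
    (hK : (∫ x in (Set.Ioc (0 : ℝ) 1) ×ˢ (Set.Icc (0 : ℝ) 1), |1 - φ x|) < ε)
    (hW : (∫ x in (Set.Icc (-1 : ℝ) 1) ×ˢ (Set.Icc (0 : ℝ) 1),
        |fderiv ℝ φ x (1, 0)| ^ p) ^ (1 / p) < ε) :
    1 < (2 + (2 : ℝ) ^ (1 / p')) * ε := by
  have hfd : ContinuousOn (fun x => fderiv ℝ φ x (1, 0)) V :=
    (hφ.continuousOn_fderiv_of_isOpen hV le_rfl).clm_apply continuousOn_const
  have hsub1 : Set.Icc (-1 : ℝ) 0 ×ˢ Set.Icc (0 : ℝ) 1 ⊆ V :=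
    (Set.prod_mono (Set.Icc_subset_Icc le_rfl zero_le_one) le_rfl).trans hWV
  have hsub2 : Set.Icc (0 : ℝ) 1 ×ˢ Set.Icc (0 : ℝ) 1 ⊆ V :=
    (Set.prod_mono (Set.Icc_subset_Icc (by norm_num) le_rfl) le_rfl).trans hWV
  have hc := hφ.continuousOn
  obtain ⟨iB, eB⟩ := aux_fubini (-1) 0 (by norm_num) (fun x => |φ x|) (hc.mono hsub1).abs
  obtain ⟨iA, eA⟩ := aux_fubini 0 1 (by norm_num) (fun x => |1 - φ x|)
    (continuousOn_const.sub (hc.mono hsub2)).abs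
  obtain ⟨iG, eG⟩ := aux_fubini (-1) 1 (by norm_num) (fun x => |fderiv ℝ φ x (1, 0)|)
    (hfd.mono hWV).abs
  have hH := aux_holder p p' hp hpp' (fun x => fderiv ℝ φ x (1, 0)) (hfd.mono hWV)
  have hKe : (∫ x in (Set.Ioc (0 : ℝ) 1) ×ˢ (Set.Icc (0 : ℝ) 1), |1 - φ x|)
      = ∫ x in (Set.Icc (0 : ℝ) 1) ×ˢ (Set.Icc (0 : ℝ) 1), |1 - φ x| := by
    refine setIntegral_congr_set ?_
    rw [Measure.volume_eq_prod]
    exact Measure.set_prod_ae_eq Ioc_ae_eq_Icc (Filter.EventuallyEq.refl _ _)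
  have key : ∀ t ∈ Set.Icc (0 : ℝ) 1, (1 : ℝ) ≤ (∫ x in (0:ℝ)..1, |1 - φ (x, t)|)
      + (∫ x in (-1:ℝ)..0, |φ (x, t)|) + ∫ x in (-1:ℝ)..1, |fderiv ℝ φ (x, t) (1, 0)| := by
    intro t ht
    have hmap : ∀ x ∈ Set.Icc (-1 : ℝ) 1, (x, t) ∈ V := fun x hx => hWV ⟨hx, ht⟩
    have hpc : Continuous fun x : ℝ => (x, t) := by fun_prop
    have cφ : ContinuousOn (fun x : ℝ => φ (x, t)) (Set.Icc (-1) 1) :=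
      hc.comp hpc.continuousOn hmap
    have cD : ContinuousOn (fun x : ℝ => fderiv ℝ φ (x, t) (1, 0)) (Set.Icc (-1) 1) :=
      hfd.comp hpc.continuousOn hmap
    have hder : ∀ x ∈ Set.Icc (-1 : ℝ) 1,
        HasDerivAt (fun x : ℝ => φ (x, t)) (fderiv ℝ φ (x, t) (1, 0)) x := by
      intro x hx
      have h1 : HasFDerivAt φ (fderiv ℝ φ (x, t)) (x, t) :=
        ((hφ.differentiableOn one_ne_zero).differentiableAt
          (hV.mem_nhds (hmap x hx))).hasFDerivAt
      have h2 : HasDerivAt (fun x : ℝ => (x, t)) ((1 : ℝ), (0 : ℝ)) x :=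
        (hasDerivAt_id x).prodMk (hasDerivAt_const x t)
      exact h1.comp_hasDerivAt x h2
    set G := ∫ x in (-1:ℝ)..1, |fderiv ℝ φ (x, t) (1, 0)| with hG
    have pt : ∀ x ∈ Set.Icc (0 : ℝ) 1, (1 : ℝ) ≤ |1 - φ (x, t)| + |φ (x - 1, t)| + G := by
      intro x hx
      have hs : Set.Icc (x - 1) x ⊆ Set.Icc (-1 : ℝ) 1 :=
        Set.Icc_subset_Icc (by linarith [hx.1]) hx.2
      have hle : x - 1 ≤ x := by linarith
      have ftc : ∫ s in (x-1)..x, fderiv ℝ φ (s, t) (1, 0) = φ (x, t) - φ (x - 1, t) := by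
        refine intervalIntegral.integral_eq_sub_of_hasDerivAt
          (f := fun s : ℝ => φ (s, t)) ?_ ?_
        · intro s hs'
          rw [Set.uIcc_of_le hle] at hs'
          exact hder s (hs hs')
        · exact (cD.mono hs).intervalIntegrable_of_Icc hle
      have h1 : |φ (x, t) - φ (x - 1, t)| ≤ G := by
        rw [← ftc]
        refine (intervalIntegral.abs_integral_le_integral_abs hle).trans ?_
        refine intervalIntegral.integral_mono_interval (by linarith [hx.1]) hle hx.2 ?_ ?_
        · exact Filter.Eventually.of_forall fun _ => abs_nonneg _
        · exact cD.abs.intervalIntegrable_of_Icc (by norm_num)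
      have h2 := le_abs_self (1 - φ (x, t))
      have h3 := le_abs_self (φ (x - 1, t))
      have h4 := le_abs_self (φ (x, t) - φ (x - 1, t))
      linarith
    have iA' : IntervalIntegrable (fun x : ℝ => |1 - φ (x, t)|) volume 0 1 :=
      ((continuousOn_const.sub (cφ.mono
        (Set.Icc_subset_Icc (by norm_num) le_rfl))).abs).intervalIntegrable_of_Icc (by norm_num)
    have iB' : IntervalIntegrable (fun x : ℝ => |φ (x - 1, t)|) volume 0 1 := by
      refine ContinuousOn.intervalIntegrable_of_Icc (by norm_num) ?_
      refine (cφ.comp (f := fun x : ℝ => x - 1) (by fun_prop) ?_).abs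
      intro x hx
      exact ⟨by linarith [hx.1], by linarith [hx.2]⟩
    have h := intervalIntegral.integral_mono_on (μ := volume) (a := (0:ℝ)) (b := 1)
      (f := fun _ => (1:ℝ)) (by norm_num) (by simp)
      ((iA'.add iB').add (intervalIntegrable_const (c := G))) pt
    rw [intervalIntegral.integral_add (iA'.add iB') intervalIntegrable_const,
      intervalIntegral.integral_add iA' iB',
      intervalIntegral.integral_comp_sub_right (fun x => |φ (x, t)|)] at h
    norm_num at h
    exact h
  have hfin := setIntegral_mono_on (μ := volume) (f := fun _ => (1:ℝ))
    (by simp) ((iA.add iB).add iG) measurableSet_Icc key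
  have e : (∫ t in Set.Icc (0:ℝ) 1, (((fun t => ∫ x in (0:ℝ)..1, |1 - φ (x, t)|)
      + fun t => ∫ x in (-1:ℝ)..0, |φ (x, t)|)
      + fun t => ∫ x in (-1:ℝ)..1, |fderiv ℝ φ (x, t) (1, 0)|) t) = _ :=
    integral_add (iA.add iB) iG
  have e' := integral_add iA iB
  simp only [Pi.add_apply] at hfin e e'
  rw [e, e', ← eA, ← eB, ← eG, ← hKe] at hfin
  simp [-Set.Icc_prod_Icc] at hfin
  have h2 : (0:ℝ) < 2 ^ (1 / p') := by positivity
  have := mul_lt_mul_of_pos_left hW h2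
  simp only [one_div] at *
  linarith
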